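/- arXiv:2204.13889 — 6 statements merged into one kernel-verified Lean document; each statement's English description precedes it below -/
import Mathlib

section
/- Let r₀ ∈ (0,1], ε > 0, C > 0 and D ≥ 0. Let q : (0, r₀] → ℝ satisfy: q(r) ≥ 0 for all r ∈ (0, r₀]; q(r) ≤ C · r^ε · q(2r) for all r ∈ (0, r₀/2]; and q(s) ≤ D for all s ∈ [r₀/2, r₀]. Then there exist C′ > 0 and r₁ ∈ (0, r₀] such that q(r) ≤ C′ · exp(−(ε/3)·(log r)²) for all r ∈ (0, r₁]. -/
/-- Induction along halvings: a property that holds on `[s, b]` and passes from `2 * r` to `r`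
for `0 < r < s` holds on `(0, b]`. -/
theorem halving_induction {P : ℝ → Prop} {s b : ℝ} (hsb : 2 * s ≤ b)
    (base : ∀ r, s ≤ r → r ≤ b → P r) (step : ∀ r, 0 < r → r < s → P (2 * r) → P r)
    {r : ℝ} (hr : 0 < r) (hrb : r ≤ b) : P r := by
  have key : ∀ n : ℕ, ∀ r : ℝ, 0 < r → r ≤ b → s ≤ 2 ^ n * r → P r := by
    intro n
    induction n with
    | zero => intro r _ hrb h; exact base r (by simpa using h) hrb
    | succ n ih =>
      intro r hr hrb h
      rcases le_or_gt s r with hsr | hsr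
      · exact base r hsr hrb
      · refine step r hr hsr (ih (2 * r) (by linarith) (by linarith) ?_)
        rw [pow_succ] at h
        linarith
  obtain ⟨n, hn⟩ := pow_unbounded_of_one_lt (s / r) (one_lt_two (α := ℝ))
  exact key n r hr hrb ((div_lt_iff₀ hr).1 hn).le

/-- A nonnegative function with `q r ≤ K * q (2 * r)` that is bounded on `[b / 2, b]` is bounded on
`[b / 2 ^ (n + 1), b]`. -/
theorem le_mul_pow_of_le_mul_double {q : ℝ → ℝ} {b D K : ℝ} (hb : 0 < b) (hD : 0 ≤ D)
    (hK : 1 ≤ K) (hq : ∀ r, 0 < r → r ≤ b / 2 → q r ≤ K * q (2 * r))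
    (htop : ∀ r, b / 2 ≤ r → r ≤ b → q r ≤ D) (n : ℕ) :
    ∀ r, b / 2 ^ (n + 1) ≤ r → r ≤ b → q r ≤ D * K ^ n := by
  induction n with
  | zero => simpa using htop
  | succ n ih =>
    intro r hr hrb
    have hr0 : 0 < r := lt_of_lt_of_le (by positivity) hr
    rcases le_or_gt (b / 2) r with h | h
    · exact (htop r h hrb).trans (le_mul_of_one_le_right hD (one_le_pow₀ hK))
    · have h2 : b / 2 ^ (n + 1) ≤ 2 * r := by
        rw [div_le_iff₀ (by positivity)] at hr ⊢
        rw [pow_succ] at hr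
        linarith
      calc q r ≤ K * q (2 * r) := hq r hr0 h.le
        _ ≤ K * (D * K ^ n) :=
          mul_le_mul_of_nonneg_left (ih (2 * r) h2 (by linarith)) (by linarith)
        _ = D * K ^ (n + 1) := by ring

/-- For small `r`, the function `exp (-(ε / 3) * (log r) ^ 2)` is a supersolution of the doubling
inequality. -/
theorem mul_rpow_mul_exp_neg_sq_log_le {ε C r : ℝ} (hε : 0 < ε) (hC : 0 < C) (hr : 0 < r)
    (hr1 : r ≤ 1) (hlog : Real.log r ≤ -(3 * Real.log C / ε)) :
    C * r ^ ε * Real.exp (-(ε / 3) * Real.log (2 * r) ^ 2) ≤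
      Real.exp (-(ε / 3) * Real.log r ^ 2) := by
  have hL0 : 0 < Real.log 2 := Real.log_pos one_lt_two
  have hL1 : Real.log 2 < 1 := by linarith [Real.log_two_lt_d9]
  have ht : Real.log r ≤ 0 := Real.log_nonpos hr.le hr1
  have hCt : 3 * Real.log C ≤ -Real.log r * ε := by
    rw [← div_le_iff₀ hε]
    linarith
  rw [Real.rpow_def_of_pos hr, Real.log_mul two_ne_zero hr.ne']
  nth_rewrite 1 [← Real.exp_log hC]
  rw [← Real.exp_add, ← Real.exp_add, Real.exp_le_exp]
  have h1 : 0 ≤ ε * -Real.log r * (1 - Real.log 2) :=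
    mul_nonneg (mul_nonneg hε.le (by linarith)) (by linarith)
  have h2 : 0 ≤ ε * Real.log 2 ^ 2 := by positivity
  linarith


/-- Gaussian-in-log decay estimate (Step 4 of the counterexample construction). -/
theorem gaussian_log_decay (r₀ ε C D : ℝ) (q : ℝ → ℝ)
    (hr₀ : 0 < r₀) (hr₀1 : r₀ ≤ 1) (hε : 0 < ε) (hC : 0 < C) (hD : 0 ≤ D)
    (hq_nonneg : ∀ r : ℝ, 0 < r → r ≤ r₀ → 0 ≤ q r)
    (hq_decay : ∀ r : ℝ, 0 < r → r ≤ r₀ / 2 → q r ≤ C * r ^ ε * q (2 * r))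
    (hq_top : ∀ s : ℝ, r₀ / 2 ≤ s → s ≤ r₀ → q s ≤ D) :
    ∃ C' : ℝ, 0 < C' ∧ ∃ r₁ : ℝ, 0 < r₁ ∧ r₁ ≤ r₀ ∧
      ∀ r : ℝ, 0 < r → r ≤ r₁ →
        q r ≤ C' * Real.exp (-(ε / 3) * (Real.log r) ^ 2) := by
  have ht0 : ∀ r : ℝ, 0 < r → r ≤ r₀ → Real.log r ≤ 0 := fun r h h' =>
    Real.log_nonpos h.le (h'.trans hr₀1)
  have hbound := le_mul_pow_of_le_mul_double (K := max C 1) hr₀ hD (le_max_right _ _)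
    (fun r hr hr2 => (hq_decay r hr hr2).trans (mul_le_mul_of_nonneg_right
      ((mul_le_of_le_one_right hC.le
        (Real.rpow_le_one hr.le (by linarith) hε.le)).trans (le_max_left _ _))
      (hq_nonneg _ (by linarith) (by linarith)))) hq_top
  obtain ⟨n, hn⟩ := pow_unbounded_of_one_lt (r₀ / Real.exp (-(3 * Real.log C / ε)))
    (one_lt_two (α := ℝ))
  set s := r₀ / 2 ^ (n + 1) with hs_def
  have hs : 0 < s := by positivity
  have hpow : (1 : ℝ) ≤ 2 ^ n := one_le_pow₀ one_le_two
  have hs2 : 2 * s * 2 ^ n = r₀ := by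
    rw [hs_def, pow_succ]
    field_simp
  have hsb : 2 * s ≤ r₀ := by nlinarith
  have hs_exp : s ≤ Real.exp (-(3 * Real.log C / ε)) := by
    rw [div_lt_iff₀ (Real.exp_pos _)] at hn
    by_contra! h
    nlinarith
  have hB : 0 ≤ D * max C 1 ^ n := by positivity
  set B := D * max C 1 ^ n
  refine ⟨(B + 1) * Real.exp (ε / 3 * Real.log s ^ 2), by positivity, r₀, hr₀, le_rfl,
    fun r hr hrb => ?_⟩
  refine halving_induction (P := fun r => q r ≤ (B + 1) * Real.exp (ε / 3 * Real.log s ^ 2) *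
    Real.exp (-(ε / 3) * Real.log r ^ 2)) hsb ?_ ?_ hr hrb
  · intro r hsr hrb
    have hsq : Real.log r ^ 2 ≤ Real.log s ^ 2 := by
      have h1 := Real.log_le_log hs hsr
      have h2 := ht0 r (hs.trans_le hsr) hrb
      nlinarith
    rw [mul_assoc, ← Real.exp_add]
    have hexp : 1 ≤ Real.exp (ε / 3 * Real.log s ^ 2 + -(ε / 3) * Real.log r ^ 2) :=
      Real.one_le_exp (by nlinarith)
    have := hbound n r hsr hrb
    nlinarith
  · intro r hr hrs ih
    have hlog : Real.log r ≤ -(3 * Real.log C / ε) :=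
      (Real.log_le_iff_le_exp hr).2 (hrs.le.trans hs_exp)
    calc q r ≤ C * r ^ ε * q (2 * r) := hq_decay r hr (by linarith)
      _ ≤ C * r ^ ε * ((B + 1) * Real.exp (ε / 3 * Real.log s ^ 2) *
          Real.exp (-(ε / 3) * Real.log (2 * r) ^ 2)) :=
        mul_le_mul_of_nonneg_left ih (by positivity)
      _ = (B + 1) * Real.exp (ε / 3 * Real.log s ^ 2) *
          (C * r ^ ε * Real.exp (-(ε / 3) * Real.log (2 * r) ^ 2)) := by ring
      _ ≤ _ := mul_le_mul_of_nonneg_left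
        (mul_rpow_mul_exp_neg_sq_log_le hε hC hr (by linarith) hlog) (by positivity)
end

section
/- Let K > 0 and let a < b be real numbers with (b − a)·√K < π. Let h : ℝ → ℝ satisfy h(x) ≥ 0 for all x ∈ (a,b), and the σ-concavity inequality: for all x₀, x₁ ∈ (a,b) with x₀ ≠ x₁ and all t ∈ [0,1], writing θ = |x₁ − x₀|, one has h((1−t)·x₀ + t·x₁) ≥ (sin((1−t)θ√K)/sin(θ√K))·h(x₀) + (sin(tθ√K)/sin(θ√K))·h(x₁). Then h is locally Lipschitz on (a,b): for all c, d with a < c < d < b there exists L ≥ 0 such that h is Lipschitz with constant L on [c,d]. -/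
open Set in
/-- On `[0, π]` the sine dominates its chord from the origin. -/
theorem mul_sin_le_sin_mul {t x : ℝ} (ht : t ∈ Icc (0 : ℝ) 1) (hx : x ∈ Icc 0 Real.pi) :
    t * Real.sin x ≤ Real.sin (t * x) := by
  simpa using strictConcaveOn_sin_Icc.concaveOn.2 (left_mem_Icc.2 Real.pi_nonneg) hx
    (sub_nonneg.2 ht.2) ht.1 (sub_add_cancel 1 t)

/-- A nonnegative function satisfying the `σ`-concavity inequality is concave. -/
theorem concaveOn_of_sigma_concave {K a b : ℝ} {h : ℝ → ℝ}
    (hK : 0 < K) (hlen : (b - a) * Real.sqrt K < Real.pi)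
    (h_nonneg : ∀ x ∈ Set.Ioo a b, 0 ≤ h x)
    (h_conc : ∀ x₀ ∈ Set.Ioo a b, ∀ x₁ ∈ Set.Ioo a b, x₀ ≠ x₁ →
      ∀ t ∈ Set.Icc (0 : ℝ) 1,
        Real.sin ((1 - t) * |x₁ - x₀| * Real.sqrt K) / Real.sin (|x₁ - x₀| * Real.sqrt K) * h x₀
          + Real.sin (t * |x₁ - x₀| * Real.sqrt K) / Real.sin (|x₁ - x₀| * Real.sqrt K) * h x₁
        ≤ h ((1 - t) * x₀ + t * x₁)) :
    ConcaveOn ℝ (Set.Ioo a b) h := by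
  refine ⟨convex_Ioo a b, fun x hx y hy s t hs ht hst => ?_⟩
  obtain rfl : s = 1 - t := by linarith
  rcases eq_or_ne x y with rfl | hxy
  · simp [← add_mul]
  have hsK : 0 < Real.sqrt K := Real.sqrt_pos.2 hK
  have hθ : 0 < |y - x| * Real.sqrt K := mul_pos (abs_pos.2 (sub_ne_zero.2 hxy.symm)) hsK
  have hdist : |y - x| ≤ b - a := abs_le.2 ⟨by linarith [hx.2, hy.1], by linarith [hx.1, hy.2]⟩
  have hθπ : |y - x| * Real.sqrt K < Real.pi :=
    (mul_le_mul_of_nonneg_right hdist hsK.le).trans_lt hlen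
  have hsin := Real.sin_pos_of_pos_of_lt_pi hθ hθπ
  have hσ (u : ℝ) (hu : u ∈ Set.Icc (0 : ℝ) 1) :
      u ≤ Real.sin (u * |y - x| * Real.sqrt K) / Real.sin (|y - x| * Real.sqrt K) := by
    rw [le_div_iff₀ hsin, mul_assoc u]
    exact mul_sin_le_sin_mul hu ⟨hθ.le, hθπ.le⟩
  exact (add_le_add
    (mul_le_mul_of_nonneg_right (hσ _ ⟨hs, by linarith⟩) (h_nonneg x hx))
    (mul_le_mul_of_nonneg_right (hσ _ ⟨ht, by linarith⟩) (h_nonneg y hy))).trans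
    (h_conc x hx y hy hxy t ⟨ht, by linarith⟩)

/-- A concave function on an open interval is Lipschitz on every compact subinterval. -/
theorem ConcaveOn.exists_lipschitzOnWith_Icc {a b c d : ℝ} {h : ℝ → ℝ}
    (hh : ConcaveOn ℝ (Set.Ioo a b) h) (hac : a < c) (hdb : d < b) :
    ∃ L, LipschitzOnWith L h (Set.Icc c d) :=
  ((hh.locallyLipschitzOn isOpen_Ioo).mono
    (Set.Icc_subset_Ioo hac hdb)).exists_lipschitzOnWith_of_compact isCompact_Icc


/-- A nonnegative CD(K,1)-density (σ-concave function) on an interval is locally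
Lipschitz away from the endpoints. -/
theorem sigma_concave_locally_lipschitz (K a b : ℝ) (h : ℝ → ℝ)
    (hK : 0 < K) (hab : a < b) (hlen : (b - a) * Real.sqrt K < Real.pi)
    (h_nonneg : ∀ x ∈ Set.Ioo a b, 0 ≤ h x)
    (h_conc : ∀ x₀ ∈ Set.Ioo a b, ∀ x₁ ∈ Set.Ioo a b, x₀ ≠ x₁ →
      ∀ t ∈ Set.Icc (0 : ℝ) 1,
        Real.sin ((1 - t) * |x₁ - x₀| * Real.sqrt K) / Real.sin (|x₁ - x₀| * Real.sqrt K) * h x₀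
          + Real.sin (t * |x₁ - x₀| * Real.sqrt K) / Real.sin (|x₁ - x₀| * Real.sqrt K) * h x₁
        ≤ h ((1 - t) * x₀ + t * x₁)) :
    ∀ c d : ℝ, a < c → c < d → d < b →
      ∃ L : ℝ, 0 ≤ L ∧ LipschitzOnWith (Real.toNNReal L) h (Set.Icc c d) := by
 
  intro c d hac _ hdb
  obtain ⟨L, hL⟩ :=
    (concaveOn_of_sigma_concave hK hlen h_nonneg h_conc).exists_lipschitzOnWith_Icc hac hdb
  exact ⟨L, L.coe_nonneg, by rwa [Real.toNNReal_coe]⟩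
end

section
/- Let ε ∈ (0,1), ρ ∈ (0,1) with (1+ε)ρ^ε < 2, a = √(4 − (1+ε)²ρ^{2ε})/ρ^{1+ε}, ξ = arccos((1+ε)ρ^ε/2)/a. Let ψ : ℝ → ℝ be a C^∞ function with ψ(x) = 0 for all x ≤ 0 and ψ(x) = 1 for all x ≥ 1. Let ζ > 0 and κ > 0 with κ + ξ < π/a. Define l(t) = (1 − ψ((t−ρ)/ζ))·(ε(1+ε)/2)·t^{ε−1} − ψ((t−ρ)/ζ)·a·sin(a(t−ρ−ζ+ξ)), and define φ on (0, ρ+ζ−ξ+π/a) by: φ(r) = (1/2)r^{1+ε} for r ∈ (0,ρ]; φ(r) = (1/2)ρ^{1+ε} + (r−ρ)·((1+ε)/2)ρ^ε + ∫_ρ^r ∫_ρ^s l(t) dt ds for r ∈ [ρ, ρ+ζ]; φ(r) = sin(aξ)/a + (r−ρ−ζ)cos(aξ) + (1−ψ((r−ρ−ζ)/κ))·∫_ρ^r ∫_ρ^s l(t) dt ds + ψ((r−ρ−ζ)/κ)·∫_{ρ+ζ}^r ∫_{ρ+ζ}^s l(t) dt ds + (1−ψ((r−ρ−ζ)/κ))·ζ·cos(aξ)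 for r ∈ [ρ+ζ, ρ+ζ+κ]; and φ(r) = sin(a(r−ρ−ζ+ξ))/a for r ∈ [ρ+ζ+κ, ρ+ζ−ξ+π/a). Then the four formulas agree at the junction radii r = ρ, r = ρ+ζ and r = ρ+ζ+κ (so φ is well-defined), and φ is C^∞ on the open interval (0, ρ+ζ−ξ+π/a). -/
/-- The primitive of a smooth function on the positive half-line is smooth there. -/
lemma contDiffOn_primitive_Ioi {f : ℝ → ℝ} {c : ℝ} (hc : 0 < c)
    (hf : ContDiffOn ℝ (⊤ : ℕ∞) f (Set.Ioi 0)) :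
    ContDiffOn ℝ (⊤ : ℕ∞) (fun r => ∫ t in c..r, f t) (Set.Ioi 0) := by
  have hderiv : ∀ r ∈ Set.Ioi (0 : ℝ), HasDerivAt (fun r => ∫ t in c..r, f t) (f r) r := by
    intro r hr
    have hsub : Set.uIcc c r ⊆ Set.Ioi 0 := fun t ht =>
      lt_of_lt_of_le (lt_min hc hr) ht.1
    exact intervalIntegral.integral_hasDerivAt_right
      (hf.continuousOn.mono hsub).intervalIntegrable
      (hf.continuousOn.stronglyMeasurableAtFilter isOpen_Ioi r hr)
      (hf.continuousOn.continuousAt (isOpen_Ioi.mem_nhds hr))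
  rw [contDiffOn_infty_iff_deriv_of_isOpen isOpen_Ioi]
  exact ⟨fun r hr => (hderiv r hr).differentiableAt.differentiableWithinAt,
    hf.congr fun r hr => (hderiv r hr).deriv⟩

/-- First-order Taylor formula with the remainder written as an iterated integral. -/
lemma iterated_integral_eq_taylor {F F' g l : ℝ → ℝ} {c r : ℝ}
    (hF : ∀ s ∈ Set.uIcc c r, HasDerivAt F (F' s) s)
    (hF' : ∀ s ∈ Set.uIcc c r, HasDerivAt F' (g s) s)
    (hg : ContinuousOn g (Set.uIcc c r)) (hl : ∀ s ∈ Set.uIcc c r, l s = g s) :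
    ∫ s in c..r, ∫ t in c..s, l t = F r - F c - (r - c) * F' c := by
  have hinner : ∀ s ∈ Set.uIcc c r, ∫ t in c..s, l t = F' s - F' c := by
    intro s hs
    have hsub : Set.uIcc c s ⊆ Set.uIcc c r := Set.uIcc_subset_uIcc_left hs
    rw [intervalIntegral.integral_congr (fun t ht => hl t (hsub ht))]
    exact intervalIntegral.integral_eq_sub_of_hasDerivAt (fun t ht => hF' t (hsub ht))
      (hg.mono hsub).intervalIntegrable
  have hcont : ContinuousOn F' (Set.uIcc c r) := fun s hs =>
    (hF' s hs).continuousAt.continuousWithinAt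
  rw [intervalIntegral.integral_congr hinner,
    intervalIntegral.integral_sub hcont.intervalIntegrable intervalIntegrable_const,
    intervalIntegral.integral_eq_sub_of_hasDerivAt hF hcont.intervalIntegrable,
    intervalIntegral.integral_const, smul_eq_mul]


open intervalIntegral in
/-- Smooth gluing of the cone warping function `(1/2)r^(1+ε)` to the round-sphere
warping function `sin(ar)/a` (Step 1, K > 0 case): the four defining formulas
agree at the junction radii, and any function given piecewise by them is `C^∞`
on the whole open interval. -/
theorem glued_warping_function_smooth (ε ρ a ξ ζ κ : ℝ) (ψ l f₁ f₂ f₃ f₄ : ℝ → ℝ)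
    (hε : ε ∈ Set.Ioo (0 : ℝ) 1) (hρ : ρ ∈ Set.Ioo (0 : ℝ) 1)
    (hsmall : (1 + ε) * ρ ^ ε < 2)
    (ha : a = Real.sqrt (4 - (1 + ε) ^ 2 * ρ ^ (2 * ε)) / ρ ^ (1 + ε))
    (hξ : ξ = Real.arccos ((1 + ε) * ρ ^ ε / 2) / a)
    (hψ : ContDiff ℝ (⊤ : ℕ∞) ψ) (hψ0 : ∀ x : ℝ, x ≤ 0 → ψ x = 0) (hψ1 : ∀ x : ℝ, 1 ≤ x → ψ x = 1)
    (hζ : 0 < ζ) (hκ : 0 < κ) (hκξ : κ + ξ < Real.pi / a)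
    (hl : ∀ t : ℝ, l t = (1 - ψ ((t - ρ) / ζ)) * (ε * (1 + ε) / 2) * t ^ (ε - 1)
        - ψ ((t - ρ) / ζ) * a * Real.sin (a * (t - ρ - ζ + ξ)))
    (hf₁ : ∀ r : ℝ, f₁ r = 1 / 2 * r ^ (1 + ε))
    (hf₂ : ∀ r : ℝ, f₂ r = 1 / 2 * ρ ^ (1 + ε) + (r - ρ) * ((1 + ε) / 2) * ρ ^ ε
        + ∫ s in ρ..r, ∫ t in ρ..s, l t)
    (hf₃ : ∀ r : ℝ, f₃ r = Real.sin (a * ξ) / a + (r - ρ - ζ) * Real.cos (a * ξ)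
        + (1 - ψ ((r - (ρ + ζ)) / κ)) * (∫ s in ρ..r, ∫ t in ρ..s, l t)
        + ψ ((r - (ρ + ζ)) / κ) * (∫ s in (ρ + ζ)..r, ∫ t in (ρ + ζ)..s, l t)
        + (1 - ψ ((r - (ρ + ζ)) / κ)) * ζ * Real.cos (a * ξ))
    (hf₄ : ∀ r : ℝ, f₄ r = Real.sin (a * (r - ρ - ζ + ξ)) / a) :
    (f₁ ρ = f₂ ρ ∧ f₂ (ρ + ζ) = f₃ (ρ + ζ) ∧ f₃ (ρ + ζ + κ) = f₄ (ρ + ζ + κ)) ∧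
    ∀ φ : ℝ → ℝ,
      (∀ r : ℝ, 0 < r → r ≤ ρ → φ r = f₁ r) →
      (∀ r : ℝ, ρ ≤ r → r ≤ ρ + ζ → φ r = f₂ r) →
      (∀ r : ℝ, ρ + ζ ≤ r → r ≤ ρ + ζ + κ → φ r = f₃ r) →
      (∀ r : ℝ, ρ + ζ + κ ≤ r → r < ρ + ζ - ξ + Real.pi / a → φ r = f₄ r) →
      ContDiffOn ℝ (⊤ : ℕ∞) φ (Set.Ioo 0 (ρ + ζ - ξ + Real.pi / a)) := by
  obtain ⟨hε0, -⟩ := hε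
  obtain ⟨hρ0, -⟩ := hρ
  have hρε : 0 < ρ ^ ε := Real.rpow_pos_of_pos hρ0 _
  have hρε1 : 0 < ρ ^ (1 + ε) := Real.rpow_pos_of_pos hρ0 _
  have hsq : ρ ^ (2 * ε) = (ρ ^ ε) ^ 2 := by
    rw [mul_comm, Real.rpow_mul hρ0.le, Real.rpow_two]
  have hc0 : 0 < (1 + ε) * ρ ^ ε := by positivity
  have hrad : 0 < 4 - (1 + ε) ^ 2 * ρ ^ (2 * ε) := by rw [hsq]; nlinarith
  have ha0 : 0 < a := by rw [ha]; exact div_pos (Real.sqrt_pos.2 hrad) hρε1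
  have haξ : a * ξ = Real.arccos ((1 + ε) * ρ ^ ε / 2) := by rw [hξ]; field_simp
  have hcos : Real.cos (a * ξ) = (1 + ε) / 2 * ρ ^ ε := by
    rw [haξ, Real.cos_arccos (by linarith) (by linarith)]; ring
  have hsin : Real.sin (a * ξ) / a = 1 / 2 * ρ ^ (1 + ε) := by
    have hroot : Real.sin (a * ξ) = Real.sqrt (4 - (1 + ε) ^ 2 * ρ ^ (2 * ε)) / 2 := by
      rw [haξ, Real.sin_arccos, hsq, Real.sqrt_eq_iff_mul_self_eq_of_pos (by
        rw [hsq] at hrad; exact div_pos (Real.sqrt_pos.2 hrad) two_pos)]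
      have hself := Real.mul_self_sqrt hrad.le
      rw [hsq] at hself
      linear_combination hself / 4
    have hsqrt : Real.sqrt (4 - (1 + ε) ^ 2 * ρ ^ (2 * ε)) = a * ρ ^ (1 + ε) := by
      rw [ha]; field_simp
    rw [hroot, hsqrt]; field_simp
  have h12 : ∀ r, 0 < r → r ≤ ρ → f₁ r = f₂ r := by
    intro r hr hrρ
    have hpos : ∀ s ∈ Set.uIcc ρ r, 0 < s := fun s hs => lt_of_lt_of_le (lt_min hρ0 hr) hs.1
    have hle : ∀ s ∈ Set.uIcc ρ r, s ≤ ρ := fun s hs => hs.2.trans (max_le le_rfl hrρ)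
    rw [hf₁, hf₂, iterated_integral_eq_taylor (F := fun s => 1 / 2 * s ^ (1 + ε))
      (F' := fun s => (1 + ε) / 2 * s ^ ε) (g := fun s => ε * (1 + ε) / 2 * s ^ (ε - 1))]
    · ring
    · intro s hs
      refine ((Real.hasDerivAt_rpow_const (p := 1 + ε) (Or.inl (hpos s hs).ne')).const_mul
        (1 / 2 : ℝ)).congr_deriv ?_
      rw [add_sub_cancel_left]; ring
    · intro s hs
      refine ((Real.hasDerivAt_rpow_const (p := ε) (Or.inl (hpos s hs).ne')).const_mul
        ((1 + ε) / 2)).congr_deriv ?_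
      ring
    · exact continuousOn_const.mul (continuousOn_id.rpow_const fun s hs => Or.inl (hpos s hs).ne')
    · intro s hs
      rw [hl, hψ0 _ (div_nonpos_of_nonpos_of_nonneg (by linarith [hle s hs]) hζ.le)]
      ring
  have h23 : ∀ r, r ≤ ρ + ζ → f₂ r = f₃ r := by
    intro r hr
    rw [hf₂, hf₃, hψ0 _ (div_nonpos_of_nonpos_of_nonneg (by linarith) hκ.le), hsin, hcos]
    ring
  have h34 : ∀ r, ρ + ζ + κ ≤ r → f₃ r = f₄ r := by
    intro r hr
    have hge : ∀ s ∈ Set.uIcc (ρ + ζ) r, ρ + ζ ≤ s := fun s hs =>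
      (le_min le_rfl (by linarith)).trans hs.1
    have hlin : ∀ s, HasDerivAt (fun s => a * (s - ρ - ζ + ξ)) a s := fun s => by
      simpa using ((((hasDerivAt_id s).sub_const ρ).sub_const ζ).add_const ξ).const_mul a
    rw [hf₃, hf₄, hψ1 _ ((one_le_div hκ).2 (by linarith)),
      iterated_integral_eq_taylor (c := ρ + ζ)
        (F := fun s => Real.sin (a * (s - ρ - ζ + ξ)) / a)
        (F' := fun s => Real.cos (a * (s - ρ - ζ + ξ)))
        (g := fun s => -(a * Real.sin (a * (s - ρ - ζ + ξ))))]
    · have hbase : ρ + ζ - ρ - ζ + ξ = ξ := by ring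
      simp only [hbase]
      ring
    · intro s _
      refine ((hlin s).sin.div_const a).congr_deriv ?_
      field_simp
    · intro s _
      refine (hlin s).cos.congr_deriv ?_
      ring
    · fun_prop
    · intro s hs
      rw [hl, hψ1 _ ((one_le_div hζ).2 (by linarith [hge s hs]))]
      ring
  refine ⟨⟨h12 ρ hρ0 le_rfl, h23 _ le_rfl, h34 _ le_rfl⟩, fun φ hφ₁ hφ₂ hφ₃ hφ₄ => ?_⟩
  have hψc : ∀ c d : ℝ, ContDiffOn ℝ (⊤ : ℕ∞) (fun r => ψ ((r - c) / d)) (Set.Ioi 0) :=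
    fun c d => (hψ.comp ((contDiff_id.sub contDiff_const).div_const d)).contDiffOn
  have hlsmooth : ContDiffOn ℝ (⊤ : ℕ∞) l (Set.Ioi 0) := by
    rw [funext hl]
    have hpow : ContDiffOn ℝ (⊤ : ℕ∞) (fun t : ℝ => t ^ (ε - 1)) (Set.Ioi 0) :=
      contDiffOn_id.rpow_const_of_ne fun t ht => (Set.mem_Ioi.1 ht).ne'
    have hsinsmooth : ContDiffOn ℝ (⊤ : ℕ∞) (fun t => Real.sin (a * (t - ρ - ζ + ξ)))
        (Set.Ioi 0) := by fun_prop
    exact (((contDiffOn_const.sub (hψc ρ ζ)).mul contDiffOn_const).mul hpow).sub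
      (((hψc ρ ζ).mul contDiffOn_const).mul hsinsmooth)
  have hiter : ∀ c : ℝ, 0 < c →
      ContDiffOn ℝ (⊤ : ℕ∞) (fun r => ∫ s in c..r, ∫ t in c..s, l t) (Set.Ioi 0) :=
    fun c hc => contDiffOn_primitive_Ioi hc (contDiffOn_primitive_Ioi hc hlsmooth)
  have hf₃smooth : ContDiffOn ℝ (⊤ : ℕ∞) f₃ (Set.Ioi 0) := by
    rw [funext hf₃]
    have haffine : ContDiffOn ℝ (⊤ : ℕ∞)
        (fun r => Real.sin (a * ξ) / a + (r - ρ - ζ) * Real.cos (a * ξ)) (Set.Ioi 0) := by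
      fun_prop
    have hcut := hψc (ρ + ζ) κ
    have hcut' := (contDiffOn_const (c := (1 : ℝ))).sub hcut
    exact ((haffine.add (hcut'.mul (hiter ρ hρ0))).add
      (hcut.mul (hiter (ρ + ζ) (by positivity)))).add
      ((hcut'.mul contDiffOn_const).mul contDiffOn_const)
  refine (hf₃smooth.mono fun r hr => hr.1).congr fun r hr => ?_
  rcases le_total r ρ with h1 | h1
  · rw [hφ₁ r hr.1 h1, h12 r hr.1 h1, h23 r (by linarith)]
  rcases le_total r (ρ + ζ) with h2 | h2
  · rw [hφ₂ r h1 h2, h23 r h2]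
  rcases le_total r (ρ + ζ + κ) with h3 | h3
  · exact hφ₃ r h2 h3
  · rw [hφ₄ r h3 hr.2, h34 r h3]
end

section
/- Let ε ∈ (0,1), ρ ∈ (0,1), a = ((1+ε)/2)·ρ^ε and ξ = ρ/(1+ε). Let ψ : ℝ → ℝ be a C^∞ function with ψ(x) = 0 for all x ≤ 0 and ψ(x) = 1 for all x ≥ 1. Let ζ > 0 and κ > 0. Define l(t) = (1 − ψ((t−ρ)/ζ))·(ε(1+ε)/2)·t^{ε−1}, and define φ on (0,∞) by: φ(r) = (1/2)r^{1+ε} for r ∈ (0,ρ]; φ(r) = (1/2)ρ^{1+ε} + (r−ρ)·((1+ε)/2)ρ^ε + ∫_ρ^r ∫_ρ^s l(t) dt ds for r ∈ [ρ, ρ+ζ]; φ(r) = aξ + a(r−ρ−ζ) + (1−ψ((r−ρ−ζ)/κ))·( ∫_ρ^r ∫_ρ^s l(t) dt ds + aζ ) for r ∈ [ρ+ζ, ρ+ζ+κ]; and φ(r) = a(r−ρ−ζ+ξ) for r ∈ [ρ+ζ+κ, ∞). Then the formulas agree at the junction radii r = ρ, r = ρ+ζ and r = ρ+ζ+κ (so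 φ is well-defined), and φ is C^∞ on (0,∞). -/
open Set intervalIntegral

/-- The primitive of a smooth function on an open interval is smooth. -/
theorem ContDiffOn.intervalIntegral_infty {E : Type*} [NormedAddCommGroup E] [NormedSpace ℝ E]
    [CompleteSpace E] {f : ℝ → E} {s : Set ℝ} {a : ℝ} (hf : ContDiffOn ℝ (⊤ : ℕ∞) f s)
    (hs : IsOpen s) (hs' : s.OrdConnected) (ha : a ∈ s) :
    ContDiffOn ℝ (⊤ : ℕ∞) (fun x => ∫ t in a..x, f t) s := by
  have hderiv : ∀ x ∈ s, HasDerivAt (fun x => ∫ t in a..x, f t) (f x) x := fun x hx =>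
    integral_hasDerivAt_right
      ((hf.continuousOn.mono (hs'.uIcc_subset ha hx)).intervalIntegrable)
      (hf.continuousOn.stronglyMeasurableAtFilter hs x hx)
      (hf.continuousOn.continuousAt (hs.mem_nhds hx))
  rw [contDiffOn_infty_iff_deriv_of_isOpen hs]
  exact ⟨fun x hx => (hderiv x hx).differentiableAt.differentiableWithinAt,
    hf.congr fun x hx => (hderiv x hx).deriv⟩

/-- Integrating the second derivative of `r ^ (1 + ε) / 2` twice from `ρ` recovers the
Taylor remainder of order one. -/
theorem integral_integral_rpow_sub_one {ε ρ r : ℝ} (hε : 0 < ε) :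
    (∫ s in ρ..r, ∫ t in ρ..s, ε * (1 + ε) / 2 * t ^ (ε - 1)) =
      1 / 2 * r ^ (1 + ε) - 1 / 2 * ρ ^ (1 + ε) - (r - ρ) * ((1 + ε) / 2) * ρ ^ ε := by
  have h1 : ∀ s : ℝ, (∫ t in ρ..s, ε * (1 + ε) / 2 * t ^ (ε - 1)) =
      (1 + ε) / 2 * (s ^ ε - ρ ^ ε) := fun s => by
    rw [integral_const_mul, integral_rpow (Or.inl (by linarith)), sub_add_cancel]
    field_simp
  simp only [h1]
  rw [integral_const_mul, integral_sub (intervalIntegrable_rpow' (by linarith)) (by simp),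
    integral_rpow (Or.inl (by linarith)), integral_const, add_comm ε 1, smul_eq_mul]
  field_simp

/-- Smooth gluing of the cone warping function `(1/2)r^(1+ε)` to the linear
warping function `a·r` (Step 1, K ≤ 0 case): the defining formulas agree at the
junction radii, and any function given piecewise by them is `C^∞` on `(0,∞)`. -/
theorem glued_warping_function_smooth_cone (ε ρ a ξ ζ κ : ℝ) (ψ l f₁ f₂ f₃ f₄ : ℝ → ℝ)
    (hε : ε ∈ Set.Ioo (0 : ℝ) 1) (hρ : ρ ∈ Set.Ioo (0 : ℝ) 1)
    (ha : a = (1 + ε) / 2 * ρ ^ ε)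
    (hξ : ξ = ρ / (1 + ε))
    (hψ : ContDiff ℝ (⊤ : ℕ∞) ψ) (hψ0 : ∀ x : ℝ, x ≤ 0 → ψ x = 0) (hψ1 : ∀ x : ℝ, 1 ≤ x → ψ x = 1)
    (hζ : 0 < ζ) (hκ : 0 < κ)
    (hl : ∀ t : ℝ, l t = (1 - ψ ((t - ρ) / ζ)) * (ε * (1 + ε) / 2) * t ^ (ε - 1))
    (hf₁ : ∀ r : ℝ, f₁ r = 1 / 2 * r ^ (1 + ε))
    (hf₂ : ∀ r : ℝ, f₂ r = 1 / 2 * ρ ^ (1 + ε) + (r - ρ) * ((1 + ε) / 2) * ρ ^ ε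
        + ∫ s in ρ..r, ∫ t in ρ..s, l t)
    (hf₃ : ∀ r : ℝ, f₃ r = a * ξ + a * (r - ρ - ζ)
        + (1 - ψ ((r - (ρ + ζ)) / κ)) * ((∫ s in ρ..r, ∫ t in ρ..s, l t) + a * ζ))
    (hf₄ : ∀ r : ℝ, f₄ r = a * (r - ρ - ζ + ξ)) :
    (f₁ ρ = f₂ ρ ∧ f₂ (ρ + ζ) = f₃ (ρ + ζ) ∧ f₃ (ρ + ζ + κ) = f₄ (ρ + ζ + κ)) ∧
    ∀ φ : ℝ → ℝ,
      (∀ r : ℝ, 0 < r → r ≤ ρ → φ r = f₁ r) →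
      (∀ r : ℝ, ρ ≤ r → r ≤ ρ + ζ → φ r = f₂ r) →
      (∀ r : ℝ, ρ + ζ ≤ r → r ≤ ρ + ζ + κ → φ r = f₃ r) →
      (∀ r : ℝ, ρ + ζ + κ ≤ r → φ r = f₄ r) →
      ContDiffOn ℝ (⊤ : ℕ∞) φ (Set.Ioi 0) := by
  obtain ⟨hε0, -⟩ := hε
  obtain ⟨hρ0, -⟩ := hρ
  have haξ : a * ξ = 1 / 2 * ρ ^ (1 + ε) := by
    rw [ha, hξ, Real.rpow_add hρ0, Real.rpow_one]
    field_simp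
  have h12 : ∀ r, 0 < r → r ≤ ρ → f₁ r = f₂ r := fun r hr hrρ => by
    have hI : (∫ s in ρ..r, ∫ t in ρ..s, l t) =
        ∫ s in ρ..r, ∫ t in ρ..s, ε * (1 + ε) / 2 * t ^ (ε - 1) := by
      refine integral_congr fun s hs => integral_congr fun t ht => ?_
      have htρ : t ≤ ρ := ht.2.trans (max_le le_rfl (hs.2.trans (max_le le_rfl hrρ)))
      simp only [hl, hψ0 _ (div_nonpos_of_nonpos_of_nonneg (sub_nonpos.2 htρ) hζ.le), sub_zero,
        one_mul]
    rw [hf₁, hf₂, hI, integral_integral_rpow_sub_one hε0]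
    ring
  have h23 : ∀ r, r ≤ ρ + ζ → f₂ r = f₃ r := fun r hr => by
    rw [hf₂, hf₃, hψ0 _ (div_nonpos_of_nonpos_of_nonneg (sub_nonpos.2 hr) hκ.le), haξ, ha]
    ring
  have h34 : ∀ r, ρ + ζ + κ ≤ r → f₃ r = f₄ r := fun r hr => by
    rw [hf₃, hf₄, hψ1 _ ((one_le_div hκ).2 (by linarith))]
    ring
  refine ⟨⟨h12 ρ hρ0 le_rfl, h23 _ le_rfl, h34 _ le_rfl⟩, fun φ h₁ h₂ h₃ h₄ => ?_⟩
  have hφ : EqOn φ f₃ (Ioi 0) := fun r hr => by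
    rcases le_total r ρ with h | h
    · rw [h₁ r hr h, h12 r hr h, h23 r (by linarith)]
    rcases le_total r (ρ + ζ) with h' | h'
    · rw [h₂ r h h', h23 r h']
    rcases le_total r (ρ + ζ + κ) with h'' | h''
    · exact h₃ r h' h''
    · rw [h₄ r h'', h34 r h'']
  have hl_smooth : ContDiffOn ℝ (⊤ : ℕ∞) l (Ioi 0) := by
    rw [funext hl]
    have hcut : ContDiff ℝ (⊤ : ℕ∞) fun t => (1 - ψ ((t - ρ) / ζ)) * (ε * (1 + ε) / 2) := by
      fun_prop
    exact hcut.contDiffOn.mul (contDiffOn_id.rpow_const_of_ne fun t ht => (mem_Ioi.1 ht).ne')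
  have hI_smooth := (hl_smooth.intervalIntegral_infty isOpen_Ioi ordConnected_Ioi
    (mem_Ioi.2 hρ0)).intervalIntegral_infty isOpen_Ioi ordConnected_Ioi (mem_Ioi.2 hρ0)
  refine ContDiffOn.congr ?_ hφ
  rw [funext hf₃]
  have hlin : ContDiff ℝ (⊤ : ℕ∞) fun r => a * ξ + a * (r - ρ - ζ) := by fun_prop
  have hcut : ContDiff ℝ (⊤ : ℕ∞) fun r => 1 - ψ ((r - (ρ + ζ)) / κ) := by fun_prop
  exact hlin.contDiffOn.add (hcut.contDiffOn.mul (hI_smooth.add contDiffOn_const))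
end

section
/- Let η ∈ (0,1) and A > 0. Then there exists κ₀ > 0 such that for every κ ∈ (0, κ₀] there exists a C^∞ function χ : (0,∞) → ℝ with the following properties: χ(r) = −(1−η)·log r for all r ∈ (0, A]; χ is constant on [A+2κ, ∞); χ′(r) ≤ 0 for all r ∈ (0,∞); and χ″(r) − (χ′(r))² ≥ 0 for all r ∈ (0,∞). -/
open Set in
/-- On `(0, ∞)`, `r ↦ ∫ t in A..r, g t` is a primitive of a function `g` continuous there. -/
theorem hasDerivAt_integral_of_continuousOn_Ioi {g : ℝ → ℝ} {A r : ℝ}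
    (hg : ContinuousOn g (Ioi 0)) (hA : 0 < A) (hr : 0 < r) :
    HasDerivAt (fun x => ∫ t in A..x, g t) (g r) r := by
  refine intervalIntegral.integral_hasDerivAt_right ?_ ?_ (hg.continuousAt (Ioi_mem_nhds hr))
  · exact (hg.mono fun t ht => lt_of_lt_of_le (lt_min hA hr) ht.1).intervalIntegrable
  · exact hg.stronglyMeasurableAtFilter isOpen_Ioi r hr

/-- A smooth antitone cutoff equal to `1` before `A` and to `0` after `B`. -/
theorem exists_contDiff_antitone_cutoff {A B : ℝ} (hAB : A < B) :
    ∃ φ : ℝ → ℝ, ContDiff ℝ (⊤ : ℕ∞) φ ∧ Antitone φ ∧ (∀ r, 0 ≤ φ r) ∧ (∀ r, φ r ≤ 1) ∧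
      (∀ r ≤ A, φ r = 1) ∧ (∀ r, B ≤ r → φ r = 0) := by
  have hpos : 0 < B - A := sub_pos.2 hAB
  refine ⟨fun r => 1 - Real.smoothTransition ((r - A) / (B - A)), ?_, ?_, ?_, ?_, ?_, ?_⟩
  · exact contDiff_const.sub (Real.smoothTransition.contDiff.comp
      ((contDiff_id.sub contDiff_const).div_const _))
  · intro x y hxy
    have : (x - A) / (B - A) ≤ (y - A) / (B - A) := by gcongr
    exact sub_le_sub_left (Real.smoothTransition.monotone this) 1
  · exact fun r => sub_nonneg.2 (Real.smoothTransition.le_one _)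
  · exact fun r => sub_le_self _ (Real.smoothTransition.nonneg _)
  · intro r hr
    simp [Real.smoothTransition.zero_of_nonpos
      (div_nonpos_of_nonpos_of_nonneg (sub_nonpos.2 hr) hpos.le)]
  · intro r hr
    have : 1 ≤ (r - A) / (B - A) := by rw [le_div_iff₀ hpos]; linarith
    simp [Real.smoothTransition.one_of_one_le this]

/-- Gluing the singular weight `r^(1-η)` to a constant weight: existence of a
smooth log-weight `χ` with `χ′ ≤ 0` and `χ″ − (χ′)² ≥ 0` on `(0,∞)`. -/
theorem weight_gluing (η A : ℝ) (hη : η ∈ Set.Ioo (0 : ℝ) 1) (hA : 0 < A) :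
    ∃ κ₀ : ℝ, 0 < κ₀ ∧ ∀ κ : ℝ, 0 < κ → κ ≤ κ₀ →
      ∃ χ : ℝ → ℝ, ContDiffOn ℝ (⊤ : ℕ∞) χ (Set.Ioi 0) ∧
        (∀ r : ℝ, 0 < r → r ≤ A → χ r = -(1 - η) * Real.log r) ∧
        (∃ c : ℝ, ∀ r : ℝ, A + 2 * κ ≤ r → χ r = c) ∧
        (∀ r : ℝ, 0 < r → deriv χ r ≤ 0) ∧
        (∀ r : ℝ, 0 < r → 0 ≤ deriv (deriv χ) r - (deriv χ r) ^ 2) := by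
  obtain ⟨hη₀, hη₁⟩ := hη
  refine ⟨1, one_pos, fun κ hκ _ => ?_⟩
  obtain ⟨φ, hφ, hanti, h0, h1, hleft, hright⟩ :=
    exists_contDiff_antitone_cutoff (show A < A + 2 * κ by linarith)
  have hg : ContDiffOn ℝ (⊤ : ℕ∞) (fun t => φ t / t) (Set.Ioi 0) :=
    hφ.contDiffOn.div contDiffOn_id fun t ht => ne_of_gt ht
  set χ : ℝ → ℝ := fun r => -(1 - η) * (Real.log A + ∫ t in A..r, φ t / t) with hχ
  have hder : ∀ r, 0 < r → HasDerivAt χ (-(1 - η) * (φ r / r)) r := fun r hr =>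
    ((hasDerivAt_integral_of_continuousOn_Ioi hg.continuousOn hA hr).const_add _).const_mul _
  have hderiv : Set.EqOn (deriv χ) (fun r => -(1 - η) * (φ r / r)) (Set.Ioi 0) :=
    fun r hr => (hder r hr).deriv
  refine ⟨χ, ?_, ?_, ⟨χ (A + 2 * κ), ?_⟩, ?_, ?_⟩
  · rw [contDiffOn_infty_iff_deriv_of_isOpen isOpen_Ioi]
    exact ⟨fun r hr => (hder r hr).differentiableAt.differentiableWithinAt,
      (contDiffOn_const.mul hg).congr hderiv⟩
  · intro r hr hrA
    have : ∫ t in A..r, φ t / t = ∫ t in A..r, 1 / t :=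
      intervalIntegral.integral_congr fun t ht => by
        rw [Set.uIcc_of_ge hrA] at ht
        simp only [hleft t ht.2]
    simp only [hχ, this, integral_one_div_of_pos hA hr, Real.log_div hr.ne' hA.ne']
    ring
  · intro r hr
    have hB : 0 < A + 2 * κ := by linarith
    have hint : ∀ x y : ℝ, 0 < x → 0 < y →
        IntervalIntegrable (fun t => φ t / t) MeasureTheory.volume x y := fun x y hx hy =>
      (hg.continuousOn.mono fun t ht => lt_of_lt_of_le (lt_min hx hy) ht.1).intervalIntegrable
    have hzero : ∫ t in (A + 2 * κ)..r, φ t / t = 0 := by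
      rw [intervalIntegral.integral_congr (g := fun _ => (0 : ℝ)), intervalIntegral.integral_zero]
      intro t ht
      rw [Set.uIcc_of_le hr] at ht
      simp only [hright t ht.1, zero_div]
    simp only [hχ]
    rw [← intervalIntegral.integral_add_adjacent_intervals (hint _ _ hA hB)
      (hint _ _ hB (hB.trans_le hr)), hzero, add_zero]
  · intro r hr
    rw [hderiv hr]
    have : 0 ≤ φ r / r := div_nonneg (h0 r) hr.le
    nlinarith
  · intro r hr
    have h2 : HasDerivAt (deriv χ) (-(1 - η) * ((deriv φ r * r - φ r * 1) / r ^ 2)) r := by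
      have hφr : HasDerivAt φ (deriv φ r) r := (hφ.differentiable (by simp) r).hasDerivAt
      exact ((hφr.div (hasDerivAt_id r) hr.ne').const_mul _).congr_of_eventuallyEq
        (hderiv.eventuallyEq_of_mem (Ioi_mem_nhds hr))
    rw [h2.deriv, hderiv hr]
    have hφ' : deriv φ r ≤ 0 := hanti.deriv_nonpos
    have hsq : (1 - η) * φ r ^ 2 ≤ φ r := by
      nlinarith [h0 r, h1 r, mul_nonneg (h0 r) (sub_nonneg.2 (h1 r)), sq_nonneg (φ r)]
    have key : -(1 - η) * ((deriv φ r * r - φ r * 1) / r ^ 2) - (-(1 - η) * (φ r / r)) ^ 2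
        = (1 - η) * (-deriv φ r * r + (φ r - (1 - η) * φ r ^ 2)) / r ^ 2 := by
      field_simp
      ring
    rw [key]
    have : 0 ≤ -deriv φ r * r := mul_nonneg (neg_nonneg.2 hφ') hr.le
    exact div_nonneg (mul_nonneg (by linarith) (by linarith)) (sq_nonneg r)
end

section
/- Let (X, d) be a metric space, V ∈ X, and let ε > 0 and η > 0 satisfy (π/2)·η^ε < 2. Assume that for all x, y in the open ball B(V, η) one has d(x, y) ≤ |d(V,x) − d(V,y)| + (π/2)·min(d(V,x), d(V,y))^{1+ε}. Then for all x, y ∈ B(V, η) with x ≠ V and y ≠ V, and for every path γ : [0,1] → X with γ(0) = x, γ(1) = y and γ(s₀) = V for some s₀ ∈ [0,1], the length of γ (its total variation on [0,1]) is strictly greater than d(x, y). In particular, V does not lie on any geodesic between two points of B(V, η) \ {V}. -/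
/-- If `c * η ^ ε < 2`, then for `a, b ∈ (0, η)` the quantity
`|a - b| + c * min a b ^ (1 + ε)` is strictly smaller than `a + b`. -/
theorem abs_sub_add_mul_min_rpow_lt_add {a b c ε η : ℝ} (hc : 0 ≤ c) (hε : 0 ≤ ε)
    (ha : 0 < a) (hb : 0 < b) (haη : a < η) (hcη : c * η ^ ε < 2) :
    |a - b| + c * min a b ^ (1 + ε) < a + b := by
  have hm : 0 < min a b := lt_min ha hb
  have hmη : min a b ≤ η := (min_le_left a b).trans haη.le
  have hpow : c * min a b ^ ε < 2 :=
    (mul_le_mul_of_nonneg_left (Real.rpow_le_rpow hm.le hmη hε) hc).trans_lt hcη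
  have hsum : |a - b| + 2 * min a b = a + b := by
    linarith [max_sub_min_eq_abs' a b, max_add_min a b]
  rw [Real.rpow_add hm, Real.rpow_one]
  nlinarith [mul_lt_mul_of_pos_right hpow hm]

/-- The variation of a map on `[a, b]` is at least the length of any two-step chain
`a ≤ s ≤ b`. -/
theorem edist_add_edist_le_eVariationOn_Icc {α E : Type*} [LinearOrder α]
    [PseudoEMetricSpace E] (f : α → E) {a b s : α} (hs : s ∈ Set.Icc a b) :
    edist (f a) (f s) + edist (f s) (f b) ≤ eVariationOn f (Set.Icc a b) := by
  have h := eVariationOn.Icc_add_Icc f hs.1 hs.2 (Set.mem_univ s)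
  simp only [Set.univ_inter] at h
  rw [← h]
  exact add_le_add
    (eVariationOn.edist_le f (Set.left_mem_Icc.2 hs.1) (Set.right_mem_Icc.2 hs.1))
    (eVariationOn.edist_le f (Set.left_mem_Icc.2 hs.2) (Set.right_mem_Icc.2 hs.2))

/-- The vertex lemma: under the cone-like distance estimate near `V`, any path
between two points of `B(V,η) \ {V}` passing through `V` is strictly longer than
the distance between its endpoints; in particular `V` lies on no geodesic
between such points. -/
theorem vertex_not_interior_of_path (X : Type*) [MetricSpace X] (V : X) (ε η : ℝ)
    (hε : 0 < ε) (hη : 0 < η) (hcond : Real.pi / 2 * η ^ ε < 2)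
    (hdist : ∀ x ∈ Metric.ball V η, ∀ y ∈ Metric.ball V η,
      dist x y ≤ |dist V x - dist V y|
        + Real.pi / 2 * min (dist V x) (dist V y) ^ (1 + ε)) :
    ∀ x ∈ Metric.ball V η, ∀ y ∈ Metric.ball V η, x ≠ V → y ≠ V →
      ∀ γ : ℝ → X, ContinuousOn γ (Set.Icc 0 1) → γ 0 = x → γ 1 = y →
        (∃ s₀ ∈ Set.Icc (0 : ℝ) 1, γ s₀ = V) →
        ENNReal.ofReal (dist x y) < eVariationOn γ (Set.Icc 0 1) := by
  intro x hx y hy hxV hyV γ _ h0 h1 hγ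
  obtain ⟨s, hs, hsV⟩ := hγ
  have hlt : dist x y < dist x V + dist V y := by
    rw [dist_comm x V]
    exact (hdist x hx y hy).trans_lt
      (abs_sub_add_mul_min_rpow_lt_add (by positivity) hε.le (dist_pos.2 hxV.symm)
        (dist_pos.2 hyV.symm) (Metric.mem_ball'.1 hx) hcond)
  have hpos : 0 < dist x V + dist V y := dist_nonneg.trans_lt hlt
  calc
    ENNReal.ofReal (dist x y) < ENNReal.ofReal (dist x V + dist V y) :=
      (ENNReal.ofReal_lt_ofReal_iff hpos).2 hlt
    _ = edist (γ 0) (γ s) + edist (γ s) (γ 1) := by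
      rw [ENNReal.ofReal_add dist_nonneg dist_nonneg, h0, h1, hsV, edist_dist, edist_dist]
    _ ≤ eVariationOn γ (Set.Icc 0 1) := edist_add_edist_le_eVariationOn_Icc γ hs
end
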